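/- There exists a constant M = M(n) > 0 depending only on n with the following property: for every closed subset A of ℝⁿ and every convex, Lipschitz and coercive function h : ℝⁿ → ℝ that is differentiable at every point of A, there exists a convex, Lipschitz and coercive function H : ℝⁿ → ℝ of class C¹ such that H = h and ∇H = ∇h on A, and Lip(H) ≤ M · Lip(h). -/

import Mathlib

open Filter Topology Set
open scoped RealInnerProductSpace NNReal

noncomputable section

section ConvexDifferentiability

variable {E : Type*} [NormedAddCommGroup E] [NormedSpace ℝ E]

/-- A convex function touched from above by a differentiable function is differentiable at the
point of contact, with the same derivative. -/
theorem ConvexOn.hasFDerivAt_of_le {f φ : E → ℝ} {φ' : E →L[ℝ] ℝ} {x : E}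
    (hf : ConvexOn ℝ univ f) (hφ : HasFDerivAt φ φ' x) (hle : ∀ z, f z ≤ φ z)
    (heq : f x = φ x) : HasFDerivAt f φ' x := by
  rw [hasFDerivAt_iff_isLittleO_nhds_zero] at hφ ⊢
  rw [Asymptotics.isLittleO_iff] at hφ ⊢
  intro ε hε
  have hpos := hφ hε
  have hneg : ∀ᶠ u in 𝓝 (0 : E), ‖φ (x + -u) - φ x - φ' (-u)‖ ≤ ε * ‖-u‖ := by
    have : Tendsto (fun u : E => -u) (𝓝 0) (𝓝 0) := by
      simpa using (continuous_neg (G := E)).tendsto 0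
    exact this.eventually hpos
  filter_upwards [hpos, hneg] with u h₁ h₂
  rw [Real.norm_eq_abs, abs_le] at h₁ h₂ ⊢
  rw [norm_neg, map_neg] at h₂
  have hmid := hf.2 (mem_univ (x + u)) (mem_univ (x + -u))
    (show (0 : ℝ) ≤ 1 / 2 by norm_num) (show (0 : ℝ) ≤ 1 / 2 by norm_num) (by norm_num)
  have hx : (1 / 2 : ℝ) • (x + u) + (1 / 2 : ℝ) • (x + -u) = x := by module
  rw [hx, smul_eq_mul, smul_eq_mul] at hmid
  have h₃ := hle (x + u)
  have h₄ := hle (x + -u)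
  constructor <;> linarith [h₁.1, h₁.2, h₂.1, h₂.2]

/-- The tangent hyperplanes of a convex function lie below its graph. -/
theorem ConvexOn.add_fderiv_sub_le {f : E → ℝ} {f' : E →L[ℝ] ℝ} {x : E}
    (hf : ConvexOn ℝ univ f) (hx : HasFDerivAt f f' x) (y : E) :
    f x + f' (y - x) ≤ f y := by
  have hline : ConvexOn ℝ univ (f ∘ AffineMap.lineMap x y : ℝ → ℝ) :=
    hf.comp_affineMap (AffineMap.lineMap x y)
  have hx' : HasFDerivAt f f' (AffineMap.lineMap x y (0 : ℝ)) := by simpa using hx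
  have hderiv := hx'.comp_hasDerivAt (0 : ℝ) AffineMap.hasDerivAt_lineMap
  have := hline.le_slope_of_hasDerivAt (mem_univ 0) (mem_univ 1) one_pos hderiv
  simp [slope] at this
  rw [map_sub]
  linarith

/-- A Lipschitz convex function which is differentiable everywhere is of class `C¹`. -/
theorem ConvexOn.contDiff_one_of_lipschitzWith {f : E → ℝ} {K : ℝ≥0}
    (hf : ConvexOn ℝ univ f) (hK : LipschitzWith K f) (hd : Differentiable ℝ f) :
    ContDiff ℝ 1 f := by
  rw [contDiff_one_iff_fderiv]
  refine ⟨hd, continuous_iff_continuousAt.2 fun x => ?_⟩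
  rw [ContinuousAt, tendsto_iff_norm_sub_tendsto_zero, Metric.tendsto_nhds]
  intro ε hε
  have hx := (hd x).hasFDerivAt
  rw [hasFDerivAt_iff_isLittleO_nhds_zero, Asymptotics.isLittleO_iff] at hx
  obtain ⟨r, hr, hball⟩ := Metric.eventually_nhds_iff.1 (hx (show 0 < ε / 4 by positivity))
  obtain ⟨s, hs, hsr⟩ := exists_between hr
  have hnear : ∀ᶠ z in 𝓝 x, 2 * K * dist z x < ε / 4 * s := by
    have : Tendsto (fun z => 2 * (K : ℝ) * dist z x) (𝓝 x) (𝓝 (2 * K * dist x x)) :=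
      (by fun_prop : Continuous fun z => 2 * (K : ℝ) * dist z x).tendsto x
    exact this.eventually_lt_const (by simp; positivity)
  filter_upwards [hnear] with z hz
  have hupper : ∀ v : E, ‖v‖ = 1 → (fderiv ℝ f z - fderiv ℝ f x) v ≤ ε / 2 := by
    intro v hv
    have hsv : ‖s • v‖ = s := by rw [norm_smul, hv, Real.norm_of_nonneg hs.le, mul_one]
    have h₁ := hball (y := s • v) (by rwa [dist_zero_right, hsv])
    rw [Real.norm_eq_abs, abs_le, hsv] at h₁
    have h₂ := hf.add_fderiv_sub_le (hd z).hasFDerivAt (z + s • v)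
    rw [add_sub_cancel_left] at h₂
    have h₃ := hK.le_add_mul (z + s • v) (x + s • v)
    have h₄ := hK.le_add_mul x z
    rw [dist_add_right] at h₃
    rw [dist_comm] at h₄
    have h₅ : s * (fderiv ℝ f z - fderiv ℝ f x) v ≤ s * (ε / 2) := by
      simp only [map_smul, smul_eq_mul, sub_apply] at *
      linarith [h₁.2]
    exact le_of_mul_le_mul_left h₅ hs
  have hnorm : ‖fderiv ℝ f z - fderiv ℝ f x‖ ≤ ε / 2 := by
    refine ContinuousLinearMap.opNorm_le_of_unit_norm (by positivity) fun v hv => ?_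
    rw [Real.norm_eq_abs, abs_le]
    have := hupper (-v) (by rwa [norm_neg])
    rw [map_neg] at this
    exact ⟨by linarith, hupper v hv⟩
  rw [dist_zero_right, norm_norm]
  linarith

end ConvexDifferentiability

section ConvexEnvelope

variable {E : Type*} [NormedAddCommGroup E] [NormedSpace ℝ E]

/-- The largest convex function below `g`, provided that `g` has a convex minorant. -/
def convexEnvelope (g : E → ℝ) (x : E) : ℝ :=
  sInf {t : ℝ | (x, t) ∈ convexHull ℝ (range fun y => (y, g y))}

variable {g h : E → ℝ}

theorem le_of_mem_convexHull_graph (hconv : ConvexOn ℝ univ h) (hle : ∀ x, h x ≤ g x)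
    {p : E × ℝ} (hp : p ∈ convexHull ℝ (range fun y => (y, g y))) : h p.1 ≤ p.2 := by
  have hsub : (range fun y => (y, g y)) ⊆ {p : E × ℝ | p.1 ∈ univ ∧ h p.1 ≤ p.2} := by
    rintro _ ⟨y, rfl⟩
    exact ⟨mem_univ _, hle y⟩
  exact (convexHull_min hsub hconv.convex_epigraph hp).2

theorem nonempty_convexHull_graph_fiber (g : E → ℝ) (x : E) :
    {t : ℝ | (x, t) ∈ convexHull ℝ (range fun y => (y, g y))}.Nonempty :=
  ⟨g x, subset_convexHull ℝ _ ⟨x, rfl⟩⟩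

theorem le_convexEnvelope (hconv : ConvexOn ℝ univ h) (hle : ∀ x, h x ≤ g x) (x : E) :
    h x ≤ convexEnvelope g x :=
  le_csInf (nonempty_convexHull_graph_fiber g x) fun _ ht =>
    le_of_mem_convexHull_graph hconv hle ht

theorem convexEnvelope_le_of_mem (hconv : ConvexOn ℝ univ h) (hle : ∀ x, h x ≤ g x)
    {x : E} {t : ℝ} (ht : (x, t) ∈ convexHull ℝ (range fun y => (y, g y))) :
    convexEnvelope g x ≤ t :=
  csInf_le ⟨h x, fun _ hs => le_of_mem_convexHull_graph hconv hle hs⟩ ht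

theorem convexEnvelope_le (hconv : ConvexOn ℝ univ h) (hle : ∀ x, h x ≤ g x) (x : E) :
    convexEnvelope g x ≤ g x :=
  convexEnvelope_le_of_mem hconv hle (subset_convexHull ℝ _ ⟨x, rfl⟩)

theorem exists_mem_convexHull_graph_lt (g : E → ℝ) (x : E) {ε : ℝ} (hε : 0 < ε) :
    ∃ t < convexEnvelope g x + ε, (x, t) ∈ convexHull ℝ (range fun y => (y, g y)) := by
  obtain ⟨t, ht, hlt⟩ := exists_lt_of_csInf_lt (nonempty_convexHull_graph_fiber g x)
    (lt_add_of_pos_right (convexEnvelope g x) hε)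
  exact ⟨t, hlt, ht⟩

theorem convexOn_convexEnvelope (hconv : ConvexOn ℝ univ h) (hle : ∀ x, h x ≤ g x) :
    ConvexOn ℝ univ (convexEnvelope g) := by
  refine ⟨convex_univ, fun x _ y _ a b ha hb hab => le_of_forall_pos_le_add fun ε hε => ?_⟩
  obtain ⟨s, hs, hsx⟩ := exists_mem_convexHull_graph_lt g x hε
  obtain ⟨t, ht, hty⟩ := exists_mem_convexHull_graph_lt g y hε
  have hmem := convex_convexHull ℝ (range fun y => (y, g y)) hsx hty ha hb hab
  refine (convexEnvelope_le_of_mem (t := a * s + b * t) hconv hle (by simpa using hmem)).trans ?_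
  have h₁ := mul_le_mul_of_nonneg_left hs.le ha
  have h₂ := mul_le_mul_of_nonneg_left ht.le hb
  calc a * s + b * t ≤ a * (convexEnvelope g x + ε) + b * (convexEnvelope g y + ε) := by linarith
    _ = a • convexEnvelope g x + b • convexEnvelope g y + (a + b) * ε := by
      simp only [smul_eq_mul]; ring
    _ = _ := by rw [hab, one_mul]

/-- Every point of the convex hull of the graph of `g` is a convex combination in which some
point `y` of the domain has a weight `c` bounded below in terms of the dimension only. Moving `y`
gives upper bounds for the convex envelope. -/
theorem exists_weight_of_mem_convexHull_graph [FiniteDimensional ℝ E]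
    {m : ℝ} (hm : ∀ x, m ≤ g x) {x : E} {t : ℝ}
    (ht : (x, t) ∈ convexHull ℝ (range fun y => (y, g y))) :
    ∃ c ∈ Icc ((Module.finrank ℝ (E × ℝ) + 1 : ℝ)⁻¹) 1, ∃ y : E,
      c * (g y - m) ≤ t - m ∧
      ∀ u : E, (x + u, t + c * (g (y + c⁻¹ • u) - g y)) ∈
        convexHull ℝ (range fun y => (y, g y)) := by
  classical
  obtain ⟨ι, _, z, w, hz, hind, hw, hsum, hzx⟩ := eq_pos_convex_span_of_mem_convexHull ht
  have hcard : (Fintype.card ι : ℝ) ≤ Module.finrank ℝ (E × ℝ) + 1 := by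
    exact_mod_cast hind.card_le_finrank_succ.trans
      (Nat.add_le_add_right (Submodule.finrank_le _) 1)
  have hne : (Finset.univ : Finset ι).Nonempty := by
    rw [Finset.nonempty_iff_ne_empty]
    intro h0
    rw [h0, Finset.sum_empty] at hsum
    exact zero_ne_one hsum
  obtain ⟨i, -, hi⟩ := Finset.exists_le_of_sum_le (s := Finset.univ)
    (f := fun _ : ι => (Module.finrank ℝ (E × ℝ) + 1 : ℝ)⁻¹) (g := w) hne (by
      rw [hsum, Finset.sum_const, nsmul_eq_mul, Finset.card_univ, ← div_eq_mul_inv]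
      exact div_le_one_of_le₀ hcard (by positivity))
  choose y hy using fun j => hz (mem_range_self j)
  have hyz : ∀ j, (z j).2 = g (z j).1 := fun j => by rw [← hy j]
  have hwi : w i ≤ 1 := hsum ▸ Finset.single_le_sum (fun j _ => (hw j).le) (Finset.mem_univ i)
  refine ⟨w i, ⟨hi, hwi⟩, (z i).1, ?_, fun u => ?_⟩
  · have hsnd : ∑ j, w j * (z j).2 = t := by
      simpa [Prod.snd_sum] using congrArg Prod.snd hzx
    calc w i * (g (z i).1 - m) ≤ ∑ j, w j * (g (z j).1 - m) :=
          Finset.single_le_sum (f := fun j => w j * (g (z j).1 - m))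
            (fun j _ => mul_nonneg (hw j).le (sub_nonneg.2 (hm _))) (Finset.mem_univ i)
      _ = t - m := by
        simp only [mul_sub, Finset.sum_sub_distrib, ← Finset.sum_mul, hsum, one_mul, ← hyz, hsnd]
  · set p : E × ℝ := ((z i).1 + (w i)⁻¹ • u, g ((z i).1 + (w i)⁻¹ • u)) with hp
    have hmem : ∑ j, w j • Function.update z i p j ∈ convexHull ℝ (range fun y => (y, g y)) := by
      refine (convex_convexHull ℝ _).sum_mem (fun j _ => (hw j).le) hsum fun j _ => ?_
      refine subset_convexHull ℝ _ ?_
      rcases eq_or_ne j i with rfl | hj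
      · rw [Function.update_self]
        exact mem_range_self _
      · rw [Function.update_of_ne hj]
        exact hz (mem_range_self j)
    have hupd : ∀ j, w j • Function.update z i p j =
        w j • z j + if j = i then w i • (p - z i) else 0 := by
      intro j
      rcases eq_or_ne j i with rfl | hj
      · rw [Function.update_self, if_pos rfl]
        module
      · rw [Function.update_of_ne hj, if_neg hj, add_zero]
    simp only [hupd, Finset.sum_add_distrib, Finset.sum_ite_eq', Finset.mem_univ, if_true,
      hzx] at hmem
    convert hmem using 1
    ext
    · simp [hp, smul_smul, mul_inv_cancel₀ (hw i).ne']
    · simp [hp, hyz]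

/-- At each point, the convex envelope of a coercive continuous function `g` is touched from above
by a rescaled translate of `g`. -/
theorem exists_convexEnvelope_add_le [FiniteDimensional ℝ E] (hconv : ConvexOn ℝ univ h)
    (hle : ∀ x, h x ≤ g x) (hg : Continuous g) (hcoer : Tendsto g (cocompact E) atTop) (x : E) :
    ∃ c > 0, ∃ y : E, ∀ u : E,
      convexEnvelope g (x + u) ≤ convexEnvelope g x + c * (g (y + c⁻¹ • u) - g y) := by
  obtain ⟨y₀, hy₀⟩ := hg.exists_forall_le hcoer
  set m := g y₀
  set c₀ : ℝ := (Module.finrank ℝ (E × ℝ) + 1 : ℝ)⁻¹ with hc₀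
  have hc₀pos : 0 < c₀ := by positivity
  have happrox : ∀ k : ℕ, ∃ q : ℝ × E,
      q ∈ Icc c₀ 1 ×ˢ {y | g y ≤ m + c₀⁻¹ * (convexEnvelope g x + 1 - m)} ∧
      ∀ u, convexEnvelope g (x + u) ≤ convexEnvelope g x + 1 / ((k : ℝ) + 1) +
        q.1 * (g (q.2 + q.1⁻¹ • u) - g q.2) := by
    intro k
    obtain ⟨t, htlt, ht⟩ := exists_mem_convexHull_graph_lt g x
      (Nat.one_div_pos_of_nat (α := ℝ) (n := k))
    obtain ⟨c, hc, y, hy, hu⟩ := exists_weight_of_mem_convexHull_graph hy₀ ht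
    refine ⟨(c, y), ⟨hc, ?_⟩, fun u => ?_⟩
    · have hk : 1 / ((k : ℝ) + 1) ≤ 1 := div_le_one_of_le₀ (by linarith [k.cast_nonneg (α := ℝ)])
        (by positivity)
      have h₁ : c₀ * (g y - m) ≤ convexEnvelope g x + 1 - m :=
        (mul_le_mul_of_nonneg_right hc.1 (sub_nonneg.2 (hy₀ y))).trans (by linarith)
      rw [← le_inv_mul_iff₀ hc₀pos] at h₁
      simp only [mem_ofPred_eq]
      linarith
    · have := convexEnvelope_le_of_mem hconv hle (hu u)
      simp only
      linarith
  choose q hqmem hq using happrox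
  have hcompact : IsCompact {y | g y ≤ m + c₀⁻¹ * (convexEnvelope g x + 1 - m)} := by
    obtain ⟨K, hK, hsub⟩ := mem_cocompact.1
      (hcoer.eventually_gt_atTop (m + c₀⁻¹ * (convexEnvelope g x + 1 - m)))
    refine hK.of_isClosed_subset (isClosed_le hg continuous_const) fun y hy => ?_
    by_contra hyK
    have hlt : _ < g y := hsub hyK
    exact hlt.not_ge hy
  obtain ⟨⟨c, y⟩, ⟨hc, -⟩, φ, hφ, hlim⟩ := (isCompact_Icc.prod hcompact).tendsto_subseq hqmem
  have hcpos : 0 < c := hc₀pos.trans_le hc.1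
  refine ⟨c, hcpos, y, fun u => ?_⟩
  have hlim₁ : Tendsto (fun k => (q (φ k)).1) atTop (𝓝 c) := (continuous_fst.tendsto _).comp hlim
  have hlim₂ : Tendsto (fun k => (q (φ k)).2) atTop (𝓝 y) := (continuous_snd.tendsto _).comp hlim
  have herr : Tendsto (fun k => 1 / ((φ k : ℝ) + 1)) atTop (𝓝 0) :=
    tendsto_one_div_add_atTop_nhds_zero_nat.comp hφ.tendsto_atTop
  have harg : Tendsto (fun k => (q (φ k)).2 + (q (φ k)).1⁻¹ • u) atTop (𝓝 (y + c⁻¹ • u)) :=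
    hlim₂.add ((hlim₁.inv₀ hcpos.ne').smul_const u)
  have hrhs := (herr.const_add (convexEnvelope g x)).add
    (hlim₁.mul (((hg.tendsto _).comp harg).sub ((hg.tendsto _).comp hlim₂)))
  rw [add_zero] at hrhs
  exact ge_of_tendsto' hrhs fun k => hq (φ k) u

theorem lipschitzWith_convexEnvelope [FiniteDimensional ℝ E] {K : ℝ≥0}
    (hconv : ConvexOn ℝ univ h) (hle : ∀ x, h x ≤ g x) (hg : LipschitzWith K g)
    (hcoer : Tendsto g (cocompact E) atTop) : LipschitzWith K (convexEnvelope g) := by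
  refine LipschitzWith.of_le_add_mul K fun z x => ?_
  obtain ⟨c, hc, y, hu⟩ := exists_convexEnvelope_add_le hconv hle hg.continuous hcoer x
  have h₁ := hu (z - x)
  have h₂ := hg.le_add_mul (y + c⁻¹ • (z - x)) y
  rw [dist_eq_norm, add_sub_cancel_left, norm_smul, Real.norm_of_nonneg (inv_nonneg.2 hc.le)] at h₂
  rw [add_sub_cancel] at h₁
  have h₃ : c * (g (y + c⁻¹ • (z - x)) - g y) ≤ c * (K * (c⁻¹ * ‖z - x‖)) :=
    mul_le_mul_of_nonneg_left (by linarith) hc.le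
  have h₄ : c * (K * (c⁻¹ * ‖z - x‖)) = K * ‖z - x‖ := by field_simp
  rw [dist_eq_norm]
  linarith

/-- The convex envelope of a coercive continuous function is differentiable if each point of the
function is touched from above by a differentiable function. -/
theorem differentiable_convexEnvelope [FiniteDimensional ℝ E]
    (hconv : ConvexOn ℝ univ h) (hle : ∀ x, h x ≤ g x) (hg : Continuous g)
    (hcoer : Tendsto g (cocompact E) atTop)
    (htouch : ∀ x, ∃ φ : E → ℝ, DifferentiableAt ℝ φ x ∧ (∀ z, g z ≤ φ z) ∧ g x = φ x) :
    Differentiable ℝ (convexEnvelope g) := by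
  intro x
  obtain ⟨c, hc, y, hu⟩ := exists_convexEnvelope_add_le hconv hle hg hcoer x
  obtain ⟨φ, hφ, hgφ, hy⟩ := htouch y
  have hφ' : DifferentiableAt ℝ φ (y + c⁻¹ • (x - x)) := by simpa using hφ
  have hψ : DifferentiableAt ℝ
      (fun z => convexEnvelope g x + c * (φ (y + c⁻¹ • (z - x)) - φ y)) x := by
    have := hφ'.comp x (f := fun z => y + c⁻¹ • (z - x)) (by fun_prop)
    exact ((this.sub_const (φ y)).const_mul c).const_add (convexEnvelope g x)
  refine ((convexOn_convexEnvelope hconv hle).hasFDerivAt_of_le hψ.hasFDerivAt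
    (fun z => ?_) (by simp)).differentiableAt
  have h₁ := hu (z - x)
  rw [add_sub_cancel] at h₁
  have h₂ := mul_le_mul_of_nonneg_left (hgφ (y + c⁻¹ • (z - x))) hc.le
  rw [← hy]
  linarith

end ConvexEnvelope

section TouchingMajorant

variable {E : Type*} [NormedAddCommGroup E] [InnerProductSpace ℝ E]

theorem sqrt_sq_add_sq_le_add {d a b c : ℝ} (ha : 0 ≤ a) (hb : 0 ≤ b) (hc : 0 ≤ c)
    (habc : a ≤ b + c) : √(d ^ 2 + a ^ 2) ≤ √(d ^ 2 + b ^ 2) + c := by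
  have hs : b ≤ √(d ^ 2 + b ^ 2) := Real.le_sqrt_of_sq_le (by nlinarith [sq_nonneg d])
  have hsq : √(d ^ 2 + b ^ 2) ^ 2 = d ^ 2 + b ^ 2 := Real.sq_sqrt (by positivity)
  refine Real.sqrt_le_iff.2 ⟨by positivity, ?_⟩
  nlinarith [mul_le_mul_of_nonneg_right hs hc]

/-- A coercive Lipschitz function `h` differentiable on `A` has a majorant with the same Lipschitz
constant which agrees with `h` on `A` and is everywhere touched from above by differentiable
functions. The function `δ` controls how far the majorant departs from `h`. -/
theorem exists_touched_majorant [FiniteDimensional ℝ E] {A : Set E} {h δ : E → ℝ} {L : ℝ≥0}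
    (hL : LipschitzWith L h) (hcoer : Tendsto h (cocompact E) atTop)
    (hdiff : ∀ x ∈ A, DifferentiableAt ℝ h x)
    (hδ : Continuous δ) (hδnonneg : ∀ x, 0 ≤ δ x) (hδA : ∀ x, δ x = 0 → x ∈ A)
    (hδle : ∀ a ∈ A, ∀ x, δ x ≤ ‖x - a‖ ^ 2) :
    ∃ g : E → ℝ, LipschitzWith L g ∧ (∀ x, h x ≤ g x) ∧ (∀ x ∈ A, g x = h x) ∧
      ∀ x, ∃ φ : E → ℝ, DifferentiableAt ℝ φ x ∧ (∀ z, g z ≤ φ z) ∧ g x = φ x := by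
  set F : E → E → ℝ := fun x y => h y + √(δ y ^ 2 + (L * ‖x - y‖) ^ 2) with hF
  have hmin : ∀ x, ∃ y, ∀ z, F x y ≤ F x z := fun x => by
    have hcont : Continuous (F x) := by
      have := hL.continuous
      fun_prop
    exact hcont.exists_forall_le (tendsto_atTop_mono
      (fun y => le_add_of_nonneg_right (Real.sqrt_nonneg _)) hcoer)
  choose Y hY using hmin
  have hself : ∀ x, F x x = h x + δ x := fun x => by simp [hF, Real.sqrt_sq (hδnonneg x)]
  have hge : ∀ x, h x ≤ F x (Y x) := fun x => by
    have h₁ := hL.le_add_mul x (Y x)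
    have h₂ : L * ‖x - Y x‖ ≤ √(δ (Y x) ^ 2 + (L * ‖x - Y x‖) ^ 2) :=
      Real.le_sqrt_of_sq_le (by nlinarith [sq_nonneg (δ (Y x))])
    rw [dist_eq_norm] at h₁
    simp only [hF]
    linarith
  have hle : ∀ x, F x (Y x) ≤ h x + δ x := fun x => (hY x x).trans_eq (hself x)
  have hA : ∀ x ∈ A, F x (Y x) = h x := fun x hx => by
    have := hδle x hx x
    rw [sub_self, norm_zero] at this
    exact le_antisymm (by linarith [hle x]) (hge x)
  refine ⟨fun x => F x (Y x), LipschitzWith.of_le_add_mul L fun x z => ?_, hge, hA, fun x => ?_⟩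
  · refine (hY x (Y z)).trans ?_
    have htri : L * ‖x - Y z‖ ≤ L * ‖z - Y z‖ + L * dist x z := by
      rw [← mul_add, dist_eq_norm]
      refine mul_le_mul_of_nonneg_left ?_ L.coe_nonneg
      rw [add_comm]
      exact norm_sub_le_norm_sub_add_norm_sub x z (Y z)
    have := sqrt_sq_add_sq_le_add (d := δ (Y z)) (by positivity) (by positivity)
      (by positivity) htri
    simp only [hF]
    linarith
  · by_cases hx : x ∈ A
    · refine ⟨fun z => h z + ‖z - x‖ ^ 2, ?_, fun z => ?_, by simp [hA x hx]⟩
      · exact (hdiff x hx).add ((differentiableAt_id.sub_const x).norm_sq ℝ)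
      · exact (hle z).trans (by linarith [hδle x hx z])
    · refine ⟨fun z => F z (Y x), ?_, fun z => hY z (Y x), rfl⟩
      refine DifferentiableAt.const_add _ ?_
      have hsq : DifferentiableAt ℝ (fun z => δ (Y x) ^ 2 + (L * ‖z - Y x‖) ^ 2) x := by
        simp only [mul_pow]
        exact (((differentiableAt_id.sub_const (Y x)).norm_sq ℝ).const_mul _).const_add _
      rcases eq_or_ne L 0 with rfl | hL0
      · simp
      · refine hsq.sqrt (ne_of_gt ?_)
        have hLpos : (0 : ℝ) < L := NNReal.coe_pos.2 (pos_iff_ne_zero.2 hL0)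
        rcases eq_or_ne x (Y x) with hxY | hxY
        · have : 0 < δ (Y x) := hxY ▸ (hδnonneg x).lt_of_ne fun h0 => hx (hδA x h0.symm)
          positivity
        · have : 0 < ‖x - Y x‖ := norm_pos_iff.2 (sub_ne_zero.2 hxY)
          positivity

end TouchingMajorant

theorem exists_gauge_of_isClosed {E : Type*} [NormedAddCommGroup E] {A : Set E}
    (hA : IsClosed A) :
    ∃ δ : E → ℝ, Continuous δ ∧ (∀ x, 0 ≤ δ x) ∧ (∀ x, δ x = 0 → x ∈ A) ∧
      ∀ a ∈ A, ∀ x, δ x ≤ ‖x - a‖ ^ 2 := by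
  rcases A.eq_empty_or_nonempty with rfl | hne
  · exact ⟨fun _ => 1, continuous_const, fun _ => zero_le_one, by simp, by simp⟩
  · refine ⟨fun x => Metric.infDist x A ^ 2, (Metric.continuous_infDist_pt A).pow 2,
      fun x => sq_nonneg _, fun x hx => ?_, fun a ha x => ?_⟩
    · exact (hA.mem_iff_infDist_zero hne).2 (pow_eq_zero_iff two_ne_zero |>.1 hx)
    · rw [← dist_eq_norm]
      exact pow_le_pow_left₀ Metric.infDist_nonneg (Metric.infDist_le_dist_of_mem ha) 2

/-- **Lemma 6.3.** There is a constant `M = M(n) > 0` depending only on `n` such that: for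
every closed `A ⊆ ℝⁿ` and every convex, Lipschitz and coercive `h : ℝⁿ → ℝ` differentiable
at every point of `A`, there is a convex, Lipschitz and coercive `C¹` function `H : ℝⁿ → ℝ`
with `H = h` and `∇H = ∇h` on `A` and `Lip(H) ≤ M ⬝ Lip(h)`. -/
theorem c1_convex_coercive_lipschitz_extension (n : ℕ) :
    ∃ M : ℝ≥0, 0 < M ∧
      ∀ (A : Set (EuclideanSpace ℝ (Fin n))), IsClosed A →
        ∀ (h : EuclideanSpace ℝ (Fin n) → ℝ) (L : ℝ≥0),
          ConvexOn ℝ Set.univ h →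
          LipschitzWith L h →
          Tendsto h (comap norm atTop) atTop →
          (∀ x ∈ A, DifferentiableAt ℝ h x) →
          ∃ H : EuclideanSpace ℝ (Fin n) → ℝ,
            ConvexOn ℝ Set.univ H ∧
            LipschitzWith (M * L) H ∧
            Tendsto H (comap norm atTop) atTop ∧
            ContDiff ℝ 1 H ∧
            (∀ x ∈ A, H x = h x) ∧ (∀ x ∈ A, gradient H x = gradient h x) := by
  refine ⟨1, one_pos, fun A hA h L hconv hL hcoer hdiff => ?_⟩
  have hcomap : comap norm atTop = cocompact (EuclideanSpace ℝ (Fin n)) := by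
    rw [comap_norm_atTop, Metric.cobounded_eq_cocompact]
  rw [hcomap] at hcoer ⊢
  obtain ⟨δ, hδ, hδnonneg, hδA, hδle⟩ := exists_gauge_of_isClosed hA
  obtain ⟨g, hgL, hhg, hgA, htouch⟩ :=
    exists_touched_majorant hL hcoer hdiff hδ hδnonneg hδA hδle
  have hgcoer : Tendsto g (cocompact _) atTop := tendsto_atTop_mono hhg hcoer
  have hHconv := convexOn_convexEnvelope hconv hhg
  have hHL := lipschitzWith_convexEnvelope hconv hhg hgL hgcoer
  have hHdiff := differentiable_convexEnvelope hconv hhg hgL.continuous hgcoer htouch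
  have hHge := le_convexEnvelope hconv hhg
  have hHA : ∀ x ∈ A, convexEnvelope g x = h x := fun x hx =>
    le_antisymm ((convexEnvelope_le hconv hhg x).trans_eq (hgA x hx)) (hHge x)
  refine ⟨convexEnvelope g, hHconv, by rwa [one_mul], tendsto_atTop_mono hHge hcoer,
    hHconv.contDiff_one_of_lipschitzWith hHL hHdiff, hHA, fun x hx => ?_⟩
  have hlocmin : IsLocalMin (fun z => convexEnvelope g z - h z) x :=
    Eventually.of_forall fun z => by
      simp only [hHA x hx, sub_self]
      exact sub_nonneg.2 (hHge z)
  have hzero := hlocmin.fderiv_eq_zero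
  rw [fderiv_fun_sub (hHdiff x) (hdiff x hx), sub_eq_zero] at hzero
  rw [gradient, gradient, hzero]
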